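/- arXiv:2109.08346 — 2 statements merged into one kernel-verified Lean document; each statement's English description precedes it below -/
import Mathlib

section
/- Let η > 0 and 0 ≤ ρ < 1 be real numbers, let C : ℝ^d → ℝ^d be an arbitrary map, and let (g_t)_{t≥0}, (u_t)_{t≥0}, (e_t)_{t≥0}, (W_t)_{t≥0} be sequences in ℝ^d satisfying for all t ≥ 1: u_t = ρ u_{t-1} + g_t, e_{t+1} = η u_t + e_t − C(η u_t + e_t), and W_{t+1} = W_t − C(η u_t + e_t). Define the virtual sequence W̃_t = W_t − e_t − (ηρ/(1−ρ)) u_{t−1}. Then for all t ≥ 1, W̃_{t+1} = W̃_t − (η/(1−ρ)) g_t. -/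
/-- For the compressed-SGD-with-momentum-and-error-feedback recursions
`u_t = ρ u_{t-1} + g_t`, `e_{t+1} = η u_t + e_t − C(η u_t + e_t)`,
`W_{t+1} = W_t − C(η u_t + e_t)` (for `t ≥ 1`), the virtual sequence
`W̃_t = W_t − e_t − (ηρ/(1−ρ)) u_{t−1}` satisfies
`W̃_{t+1} = W̃_t − (η/(1−ρ)) g_t` for all `t ≥ 1`. -/
theorem virtual_sequence_recursion {d : ℕ} (η ρ : ℝ) (hη : 0 < η) (hρ0 : 0 ≤ ρ) (hρ1 : ρ < 1)
    (C : EuclideanSpace ℝ (Fin d) → EuclideanSpace ℝ (Fin d))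
    (g u e W : ℕ → EuclideanSpace ℝ (Fin d))
    (hu : ∀ t, 1 ≤ t → u t = ρ • u (t - 1) + g t)
    (he : ∀ t, 1 ≤ t → e (t + 1) = η • u t + e t - C (η • u t + e t))
    (hW : ∀ t, 1 ≤ t → W (t + 1) = W t - C (η • u t + e t)) :
    ∀ t, 1 ≤ t →
      (fun s => W s - e s - ((η * ρ) / (1 - ρ)) • u (s - 1)) (t + 1) =
        (fun s => W s - e s - ((η * ρ) / (1 - ρ)) • u (s - 1)) t - (η / (1 - ρ)) • g t := by
  intro t ht
  have hρ : 1 - ρ ≠ 0 := by linarith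
  simp only [Nat.add_sub_cancel, he t ht, hW t ht, hu t ht]
  match_scalars <;> field_simp <;> ring
end

section
/- Let 0 < ε ≤ 1 and let C : ℝ^d → ℝ^d satisfy the ε-contraction property ‖x − C(x)‖² ≤ (1−ε)‖x‖² for all x ∈ ℝ^d. Let A ≥ 0 and let (a_t)_{t≥0} be vectors in ℝ^d with ‖a_t‖ ≤ A for all t. Define e_0 = 0 and e_{t+1} = a_t + e_t − C(a_t + e_t) for t ≥ 0. Then for all t ≥ 0, ‖e_t‖² ≤ 4(1−ε)A²/ε². -/
/-- If `C` is an `ε`-contractive compressor, `‖a_t‖ ≤ A` for all `t`,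
`e_0 = 0` and `e_{t+1} = a_t + e_t − C(a_t + e_t)`, then `‖e_t‖² ≤ 4(1−ε)A²/ε²` for all `t`. -/
theorem error_feedback_bound {d : ℕ} (ε : ℝ) (hε0 : 0 < ε) (hε1 : ε ≤ 1)
    (C : EuclideanSpace ℝ (Fin d) → EuclideanSpace ℝ (Fin d))
    (hC : ∀ x, ‖x - C x‖ ^ 2 ≤ (1 - ε) * ‖x‖ ^ 2)
    (A : ℝ) (hA : 0 ≤ A)
    (a : ℕ → EuclideanSpace ℝ (Fin d)) (ha : ∀ t, ‖a t‖ ≤ A)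
    (e : ℕ → EuclideanSpace ℝ (Fin d)) (he0 : e 0 = 0)
    (he : ∀ t, e (t + 1) = a t + e t - C (a t + e t)) :
    ∀ t, ‖e t‖ ^ 2 ≤ 4 * (1 - ε) * A ^ 2 / ε ^ 2 := by
  obtain ⟨s, hs0, hs⟩ : ∃ s : ℝ, 0 ≤ s ∧ s ^ 2 = 1 - ε :=
    ⟨√(1 - ε), Real.sqrt_nonneg _, Real.sq_sqrt (by linarith)⟩
  have hs2 : ε + 2 * s ≤ 2 := by nlinarith [sq_nonneg (s - 1)]
  have hres (x) : ‖x - C x‖ ≤ s * ‖x‖ := by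
    refine (sq_le_sq₀ (norm_nonneg _) (by positivity)).1 ?_
    rw [mul_pow, hs]
    exact hC x
  have key (t : ℕ) : ε * ‖e t‖ ≤ 2 * s * A := by
    induction t with
    | zero =>
      rw [he0, norm_zero, mul_zero]
      positivity
    | succ t ih =>
      rw [he t]
      calc ε * ‖a t + e t - C (a t + e t)‖
          ≤ ε * (s * ‖a t + e t‖) := by gcongr; exact hres _
        _ ≤ ε * (s * (A + ‖e t‖)) := by
          gcongr
          exact (norm_add_le _ _).trans (by gcongr; exact ha t)
        _ = s * (ε * A + ε * ‖e t‖) := by ring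
        _ ≤ s * (ε * A + 2 * s * A) := by gcongr
        _ = (ε + 2 * s) * (s * A) := by ring
        _ ≤ 2 * (s * A) := by gcongr
        _ = 2 * s * A := by ring
  intro t
  rw [le_div_iff₀ (by positivity), ← hs]
  calc ‖e t‖ ^ 2 * ε ^ 2 = (ε * ‖e t‖) ^ 2 := by ring
    _ ≤ (2 * s * A) ^ 2 := pow_le_pow_left₀ (by positivity) (key t) 2
    _ = 4 * s ^ 2 * A ^ 2 := by ring
end
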